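/- Generalized sum with exponent 0 < b < 1: Under the setup of the main theorem, the sum over 0 ≤ n ≤ N, n ≠ n', of 1/{nα - γ}^b is at most (2^{1+b}/(1-b)) N + (2^b/(1-b)) q_{K+1}^b (N/q_K)^{1-b}. -/

import Mathlib

theorem rpow_div_add_one_div_rpow_le {b : ℝ} (hb0 : 0 < b) (hb1 : b < 1) (m : ℕ) :
    (m : ℝ) ^ (1 - b) / (1 - b) + 1 / ((m : ℝ) + 1) ^ b ≤
      ((m : ℝ) + 1) ^ (1 - b) / (1 - b) := by
  have hc : 0 < 1 - b := by linarith
  have hm : (0 : ℝ) < (m : ℝ) + 1 := by positivity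
  have hinv : 1 / ((m : ℝ) + 1) ≤ 1 := by
    rw [div_le_one hm]; linarith [(Nat.cast_nonneg m : (0 : ℝ) ≤ m)]
  have bern := rpow_one_add_le_one_add_mul_self (s := -(1 / ((m : ℝ) + 1))) (by linarith)
    hc.le (by linarith : 1 - b ≤ 1)
  have hfac : (m : ℝ) = ((m : ℝ) + 1) * (1 + -(1 / ((m : ℝ) + 1))) := by field_simp; ring
  have hpow : (m : ℝ) ^ (1 - b) =
      ((m : ℝ) + 1) ^ (1 - b) * (1 + -(1 / ((m : ℝ) + 1))) ^ (1 - b) := by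
    rw [← Real.mul_rpow hm.le (by linarith), ← hfac]
  have hsplit : ((m : ℝ) + 1) ^ (1 - b) = ((m : ℝ) + 1) * (1 / ((m : ℝ) + 1) ^ b) := by
    rw [Real.rpow_sub hm, Real.rpow_one]; ring
  have hle : (m : ℝ) ^ (1 - b) ≤
      ((m : ℝ) + 1) ^ (1 - b) - (1 - b) * (1 / ((m : ℝ) + 1) ^ b) := by
    rw [hpow]
    refine (mul_le_mul_of_nonneg_left bern (Real.rpow_nonneg hm.le _)).trans_eq ?_
    rw [hsplit]; field_simp; ring
  rw [div_add' _ _ _ hc.ne']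
  gcongr
  linarith

theorem card_mul_le_of_separated {ι : Type*} [DecidableEq ι] (f : ι → ℝ) {δ : ℝ}
    (T : Finset ι) :
    (∀ i ∈ T, δ ≤ f i) → (∀ i ∈ T, ∀ j ∈ T, i ≠ j → δ ≤ |f i - f j|) →
      ∀ x, δ ≤ x → (∀ i ∈ T, f i + δ ≤ x) → ((T.card : ℝ) + 1) * δ ≤ x := by
  induction T using Finset.induction_on_max_value f with
  | empty => intro _ _ x hx _; simpa using hx
  | insert c T hc hmax ih =>
    intro hδ hsep x _ hx
    have hfc := ih (fun i hi => hδ i (Finset.mem_insert_of_mem hi))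
      (fun i hi j hj => hsep i (Finset.mem_insert_of_mem hi) j (Finset.mem_insert_of_mem hj))
      (f c) (hδ c (Finset.mem_insert_self _ _)) (fun i hi => by
        have h := hsep c (Finset.mem_insert_self _ _) i (Finset.mem_insert_of_mem hi)
          (fun h => hc (h ▸ hi))
        rw [abs_of_nonneg (by linarith [hmax i hi])] at h
        linarith)
    have := hx c (Finset.mem_insert_self _ _)
    rw [Finset.card_insert_of_notMem hc]
    push_cast
    linarith

theorem sum_one_div_rpow_le_of_separated {ι : Type*} [DecidableEq ι] (f : ι → ℝ) {δ b : ℝ}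
    (hδ0 : 0 < δ) (hb0 : 0 < b) (hb1 : b < 1) (T : Finset ι) :
    (∀ i ∈ T, δ ≤ f i) → (∀ i ∈ T, ∀ j ∈ T, i ≠ j → δ ≤ |f i - f j|) →
      ∑ i ∈ T, 1 / f i ^ b ≤ (1 / δ) ^ b * ((T.card : ℝ) ^ (1 - b) / (1 - b)) := by
  induction T using Finset.induction_on_max_value f with
  | empty => intro _ _; simp [Real.zero_rpow (by linarith : 1 - b ≠ 0)]
  | insert c T hc hmax ih =>
    intro hδ hsep
    have hδ' : ∀ i ∈ T, δ ≤ f i := fun i hi => hδ i (Finset.mem_insert_of_mem hi)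
    have hsep' : ∀ i ∈ T, ∀ j ∈ T, i ≠ j → δ ≤ |f i - f j| := fun i hi j hj =>
      hsep i (Finset.mem_insert_of_mem hi) j (Finset.mem_insert_of_mem hj)
    have hfc := card_mul_le_of_separated f T hδ' hsep'
      (f c) (hδ c (Finset.mem_insert_self _ _)) (fun i hi => by
        have h := hsep c (Finset.mem_insert_self _ _) i (Finset.mem_insert_of_mem hi)
          (fun h => hc (h ▸ hi))
        rw [abs_of_nonneg (by linarith [hmax i hi])] at h
        linarith)
    have hterm : 1 / f c ^ b ≤ (1 / δ) ^ b * (1 / ((T.card : ℝ) + 1) ^ b) := by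
      calc 1 / f c ^ b ≤ 1 / (((T.card : ℝ) + 1) * δ) ^ b := by gcongr
        _ = _ := by
          rw [Real.mul_rpow (by positivity) hδ0.le, Real.div_rpow zero_le_one hδ0.le,
            Real.one_rpow]
          field_simp
    rw [Finset.sum_insert hc, Finset.card_insert_of_notMem hc]
    push_cast
    have := mul_le_mul_of_nonneg_left (rpow_div_add_one_div_rpow_le hb0 hb1 T.card)
      (by positivity : 0 ≤ (1 / δ) ^ b)
    have := ih hδ' hsep'
    linarith

theorem abs_mul_sub_int_ge_of_lt_denominator
    (α : ℝ) (hirr : Irrational α) (a p q : ℤ → ℤ) (β : ℕ → ℝ)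
    (hβ0 : β 0 = α)
    (hβ : ∀ k : ℕ, β (k + 1) = 1 / (β k - ⌊β k⌋))
    (ha : ∀ k : ℕ, a (k : ℤ) = ⌊β k⌋)
    (hqm : q (-1) = 0) (hq0 : q 0 = 1)
    (hpm : p (-1) = 1) (hp0 : p 0 = a 0)
    (hqrec : ∀ k : ℤ, 0 ≤ k → q (k + 1) = a (k + 1) * q k + q (k - 1))
    (hprec : ∀ k : ℤ, 0 ≤ k → p (k + 1) = a (k + 1) * p k + p (k - 1)) (k : ℕ) :
    0 < q k ∧ ∀ m l : ℤ, 0 < m → m < q k → 1 / (2 * (q k : ℝ)) ≤ |(m : ℝ) * α - l| := by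
  have hβirr : ∀ k, Irrational (β k) := by
    intro k
    induction k with
    | zero => rwa [hβ0]
    | succ k ih =>
      rw [hβ, one_div]
      exact (ih.sub_intCast _).inv
  have hfpos : ∀ k, 0 < β k - ⌊β k⌋ := fun k => by
    have h1 := Int.floor_le (β k)
    have h2 : β k ≠ ⌊β k⌋ := (hβirr k).ne_int _
    exact sub_pos.2 (lt_of_le_of_ne h1 h2.symm)
  have hβ1 : ∀ k, 1 < β (k + 1) := fun k => by
    rw [hβ, lt_div_iff₀ (hfpos k)]
    linarith [Int.lt_floor_add_one (β k)]
  have ha1 : ∀ k : ℕ, 1 ≤ a ((k : ℤ) + 1) := fun k => by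
    have h := ha (k + 1)
    push_cast at h
    rw [h, Int.le_floor]
    exact_mod_cast (hβ1 k).le
  have inv : ∀ k : ℕ, 0 ≤ q ((k : ℤ) - 1) ∧ q ((k : ℤ) - 1) ≤ q k ∧ 0 < q k ∧
      (p ((k : ℤ) - 1) * q k - p k * q ((k : ℤ) - 1)) ^ 2 = 1 ∧
      (q ((k : ℤ) - 1) : ℝ) * α - p ((k : ℤ) - 1) = -(β (k + 1) * ((q k : ℝ) * α - p k)) := by
    intro k
    induction k with
    | zero =>
      have h0 := ha 0
      have hf := hfpos 0
      rw [hβ0] at hf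
      simp only [Nat.cast_zero] at h0
      simp only [Nat.cast_zero, zero_sub, hqm, hq0, hpm, hp0, h0, zero_add, hβ, hβ0]
      refine ⟨le_rfl, zero_le_one, one_pos, by norm_num, ?_⟩
      push_cast
      field_simp
      ring
    | succ k ih =>
      obtain ⟨h1, h2, h3, h4, h5⟩ := ih
      have hk : (0 : ℤ) ≤ k := Int.natCast_nonneg k
      have hq := hqrec k hk
      have hp := hprec k hk
      have hak := ha1 k
      push_cast
      rw [add_sub_cancel_right, hq, hp]
      have hmul : q k ≤ a ((k : ℤ) + 1) * q k := le_mul_of_one_le_left h3.le hak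
      refine ⟨h3.le, by linarith, by linarith, ?_, ?_⟩
      · linear_combination h4
      · have hh := ha (k + 1)
        push_cast at hh
        have hf := hfpos (k + 1)
        rw [hβ (k + 1), ← hh, one_div, ← mul_neg, eq_inv_mul_iff_mul_eq₀ (by rw [hh]; exact hf.ne')]
        push_cast
        linear_combination h5
  obtain ⟨h1, h2, h3, h4, h5⟩ := inv k
  refine ⟨h3, fun m l hm0 hm => ?_⟩
  have hB := hβ1 k
  generalize β (k + 1) = B at h5 hB
  generalize q ((k : ℤ) - 1) = q' at *
  generalize p ((k : ℤ) - 1) = p' at *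
  generalize q (k : ℤ) = Q at *
  generalize p (k : ℤ) = P at *
  obtain ⟨d, hd⟩ : ∃ d, d = p' * Q - P * q' := ⟨_, rfl⟩
  obtain ⟨x, hx⟩ : ∃ x, x = d * (l * Q - m * P) := ⟨_, rfl⟩
  obtain ⟨y, hy⟩ : ∃ y, y = d * (m * p' - l * q') := ⟨_, rfl⟩
  rw [← hd] at h4
  have hmxy : m = x * q' + y * Q := by
    rw [hx, hy]; linear_combination (-m) * h4 + m * d * hd
  have hlxy : l = x * p' + y * P := by
    rw [hx, hy]; linear_combination (-l) * h4 + l * d * hd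
  have hQ : (0 : ℝ) < Q := by exact_mod_cast h3
  have hq'Q : (q' : ℝ) ≤ Q := by exact_mod_cast h2
  have hq'0 : (0 : ℝ) ≤ q' := by exact_mod_cast h1
  set E : ℝ := (Q : ℝ) * α - P with hE
  have hval : (m : ℝ) * α - l = E * (y - x * B) := by
    rw [hmxy, hlxy]; push_cast
    linear_combination (x : ℝ) * h5
  have hge : B ≤ |(y : ℝ) - x * B| := by
    rcases lt_trichotomy x 0 with hx0 | hx0 | hx0
    · have hy0 : 0 ≤ y := by
        by_contra! h
        nlinarith
      have hxr : (x : ℝ) ≤ -1 := by exact_mod_cast (by omega : x ≤ -1)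
      have hyr : (0 : ℝ) ≤ y := by exact_mod_cast hy0
      refine le_trans ?_ (le_abs_self _)
      nlinarith
    · exfalso
      rw [hx0] at hmxy
      have : 0 < y := by by_contra! h; nlinarith
      nlinarith
    · have hy0 : y ≤ 0 := by
        by_contra! h
        nlinarith
      have hxr : (1 : ℝ) ≤ x := by exact_mod_cast hx0
      have hyr : (y : ℝ) ≤ 0 := by exact_mod_cast hy0
      refine le_trans ?_ (neg_le_abs _)
      nlinarith
  have hdet : |E| * (Q * B + q') = 1 := by
    have hdr : ((d : ℝ)) = E * (Q * B + q') := by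
      rw [hd]; push_cast
      linear_combination (-(Q : ℝ)) * h5 + (q' : ℝ) * hE
    have hdabs : |(d : ℝ)| = 1 := by
      have : (d : ℝ) ^ 2 = 1 := by exact_mod_cast h4
      rw [← sq_abs] at this
      exact (pow_eq_one_iff_of_nonneg (abs_nonneg _) two_ne_zero).1 this
    rw [← hdabs, hdr, abs_mul, abs_of_nonneg (by positivity : 0 ≤ (Q : ℝ) * B + q')]
  rw [hval, abs_mul, div_le_iff₀ (by positivity)]
  have hE0 := abs_nonneg E
  have h6 : |E| * B ≤ |E| * |(y : ℝ) - x * B| := by gcongr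
  have h7 : (q' : ℝ) ≤ Q * B := by nlinarith
  have h8 : |E| * (q' : ℝ) ≤ |E| * (Q * B) := by gcongr
  nlinarith

theorem le_abs_fract_sub_fract {α δ : ℝ} {L : ℤ} (γ : ℝ)
    (h : ∀ m l : ℤ, 0 < m → m < L → δ ≤ |(m : ℝ) * α - l|) {i j : ℕ} (hij : i ≠ j)
    (hi : (i : ℤ) - j < L) (hj : (j : ℤ) - i < L) :
    δ ≤ |Int.fract ((i : ℝ) * α - γ) - Int.fract ((j : ℝ) * α - γ)| := by
  wlog hlt : j < i generalizing i j
  · rw [abs_sub_comm]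
    exact this hij.symm hj hi (by omega)
  convert h ((i : ℤ) - j) (⌊(i : ℝ) * α - γ⌋ - ⌊(j : ℝ) * α - γ⌋) (by omega) hi using 2
  simp only [Int.fract]
  push_cast
  ring


/-- Generalized sum with exponent 0 < b < 1:
∑_{0 ≤ n ≤ N, n ≠ n'} 1/{nα - γ}^b ≤ (2^{1+b}/(1-b)) N + (2^b/(1-b)) q_{K+1}^b (N/q_K)^{1-b}. -/
theorem stmt_19
    (α : ℝ) (hirr : Irrational α)
    (a p q : ℤ → ℤ) (β : ℕ → ℝ)
    (hβ0 : β 0 = α)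
    (hβ : ∀ k : ℕ, β (k + 1) = 1 / (β k - ⌊β k⌋))
    (ha : ∀ k : ℕ, a (k : ℤ) = ⌊β k⌋)
    (hqm : q (-1) = 0) (hq0 : q 0 = 1)
    (hpm : p (-1) = 1) (hp0 : p 0 = a 0)
    (hqrec : ∀ k : ℤ, 0 ≤ k → q (k + 1) = a (k + 1) * q k + q (k - 1))
    (hprec : ∀ k : ℤ, 0 ≤ k → p (k + 1) = a (k + 1) * p k + p (k - 1))
    (D : ℤ → ℝ) (hD : ∀ k : ℤ, D k = (q k : ℝ) * α - (p k : ℝ))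
    (N : ℕ) (hN1 : 1 ≤ N) (K : ℕ)
    (hK : q (K : ℤ) ≤ (N : ℤ)) (hKmax : ∀ j : ℕ, q (j : ℤ) ≤ (N : ℤ) → j ≤ K)
    (γ : ℝ) (n' : ℕ) (hn'le : n' ≤ N)
    (hmin : ∀ m : ℕ, m ≤ N → Int.fract ((n' : ℝ) * α - γ) ≤ Int.fract ((m : ℝ) * α - γ))
    (b : ℝ) (hb : 0 < b ∧ b < 1) :
    ∑ n ∈ (Finset.range (N + 1)).erase n', 1 / Int.fract ((n : ℝ) * α - γ) ^ b ≤
      2 ^ (1 + b) / (1 - b) * (N : ℝ) +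
        2 ^ b / (1 - b) * (q ((K : ℤ) + 1) : ℝ) ^ b *
          ((N : ℝ) / (q (K : ℤ) : ℝ)) ^ (1 - b) := by
  obtain ⟨hb0, hb1⟩ := hb
  have hc : 0 < 1 - b := by linarith
  obtain ⟨hQ0, hsepK⟩ := abs_mul_sub_int_ge_of_lt_denominator α hirr a p q β hβ0 hβ ha hqm hq0
    hpm hp0 hqrec hprec K
  obtain ⟨hR0, hsepK'⟩ := abs_mul_sub_int_ge_of_lt_denominator α hirr a p q β hβ0 hβ ha hqm hq0
    hpm hp0 hqrec hprec (K + 1)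
  have hNR : (N : ℤ) < q ((K + 1 : ℕ) : ℤ) := by
    by_contra! h
    have := hKmax (K + 1) h
    omega
  push_cast at hR0 hsepK' hNR
  generalize q ((K : ℤ) + 1) = R at *
  obtain ⟨Q, hQ⟩ := Int.eq_ofNat_of_zero_le hQ0.le
  rw [hQ] at hK hQ0 hsepK ⊢
  have hQpos : 0 < Q := by exact_mod_cast hQ0
  have hQN : Q ≤ N := by exact_mod_cast hK
  have hQr : (0 : ℝ) < Q := by exact_mod_cast hQpos
  have hRr : (0 : ℝ) < R := by exact_mod_cast hR0
  simp only [Int.cast_natCast] at hsepK ⊢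
  set f : ℕ → ℝ := fun n => Int.fract ((n : ℝ) * α - γ) with hf
  have hf0 : ∀ n, 0 ≤ f n := fun n => Int.fract_nonneg _
  have hsepN : ∀ i ≤ N, ∀ j ≤ N, i ≠ j → 1 / (2 * (R : ℝ)) ≤ |f i - f j| :=
    fun i hi j hj hij => le_abs_fract_sub_fract γ hsepK' hij (by omega) (by omega)
  have hsepQ : ∀ i j, i / Q = j / Q → i ≠ j → 1 / (2 * (Q : ℝ)) ≤ |f i - f j| := by
    intro i j hdiv hij
    have e1 := Nat.div_add_mod i Q
    have e2 := Nat.div_add_mod j Q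
    have l1 := Nat.mod_lt i hQpos
    have l2 := Nat.mod_lt j hQpos
    rw [hdiv] at e1
    exact le_abs_fract_sub_fract γ hsepK hij (by omega) (by omega)
  set block : ℕ → Finset ℕ := fun j => {n ∈ Finset.range (N + 1) | n / Q = j} with hblock
  have hmem : ∀ n j, n ∈ block j ↔ n ≤ N ∧ n / Q = j := by
    intro n j; simp [hblock]
  have hex : ∀ j ∈ Finset.range (N / Q + 1), ∃ m ∈ block j, ∀ n ∈ block j, f m ≤ f n := by
    intro j hj
    refine Finset.exists_min_image _ f ⟨j * Q, (hmem _ _).2 ⟨?_, Nat.mul_div_cancel _ hQpos⟩⟩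
    have : j ≤ N / Q := by simpa [Nat.lt_succ_iff] using hj
    exact (Nat.le_div_iff_mul_le hQpos).1 this
  choose! μ hμ hμmin using hex
  have hn'block : n' / Q ∈ Finset.range (N / Q + 1) := by
    simpa [Nat.lt_succ_iff] using Nat.div_le_div_right hn'le
  have hμn' : μ (n' / Q) = n' := by
    by_contra hne
    have hm := (hmem _ _).1 (hμ _ hn'block)
    have h1 := hμmin _ hn'block n' ((hmem _ _).2 ⟨hn'le, rfl⟩)
    have h2 : f n' ≤ f (μ (n' / Q)) := hmin _ hm.1
    have h3 := hsepN _ hm.1 _ hn'le hne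
    rw [le_antisymm h1 h2, sub_self, abs_zero] at h3
    have : 0 < 1 / (2 * (R : ℝ)) := by positivity
    linarith
  have hblockcard : ∀ j, (block j).card ≤ Q := by
    intro j
    refine (Finset.card_le_card (t := Finset.Ico (j * Q) (j * Q + Q)) fun n hn => ?_).trans
      (by simp)
    have hn := ((hmem _ _).1 hn).2
    rw [Nat.div_eq_iff hQpos] at hn
    rw [Finset.mem_Ico]
    omega
  have hinner : ∀ j ∈ Finset.range (N / Q + 1),
      ∑ n ∈ (block j).erase (μ j), 1 / f n ^ b ≤ 2 ^ b / (1 - b) * Q := by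
    intro j hj
    have hμj := (hmem _ _).1 (hμ j hj)
    refine (sum_one_div_rpow_le_of_separated f (δ := 1 / (2 * (Q : ℝ))) (by positivity) hb0 hb1
      _ (fun i hi => ?_) (fun i hi i' hi' hne => ?_)).trans ?_
    · obtain ⟨hne, hi⟩ := Finset.mem_erase.1 hi
      have h := hsepQ i (μ j) (((hmem _ _).1 hi).2.trans hμj.2.symm) hne
      rw [abs_of_nonneg (sub_nonneg.2 (hμmin j hj i hi))] at h
      linarith [hf0 (μ j)]
    · exact hsepQ i i' (((hmem _ _).1 (Finset.mem_of_mem_erase hi)).2.trans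
        ((hmem _ _).1 (Finset.mem_of_mem_erase hi')).2.symm) hne
    · have hcard : ((((block j).erase (μ j)).card : ℕ) : ℝ) ≤ Q := by
        exact_mod_cast (Finset.card_erase_le).trans (hblockcard j)
      calc _ ≤ (1 / (1 / (2 * (Q : ℝ)))) ^ b * ((Q : ℝ) ^ (1 - b) / (1 - b)) := by gcongr
        _ = 2 ^ b / (1 - b) * ((Q : ℝ) ^ b * (Q : ℝ) ^ (1 - b)) := by
          rw [one_div_one_div, Real.mul_rpow zero_le_two hQr.le]; ring
        _ = _ := by rw [← Real.rpow_add hQr]; simp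
  have houter : ∑ j ∈ (Finset.range (N / Q + 1)).erase (n' / Q), 1 / f (μ j) ^ b ≤
      2 ^ b / (1 - b) * (R : ℝ) ^ b * ((N : ℝ) / (Q : ℝ)) ^ (1 - b) := by
    refine (sum_one_div_rpow_le_of_separated (fun j => f (μ j)) (δ := 1 / (2 * (R : ℝ)))
      (by positivity) hb0 hb1 _ (fun i hi => ?_) (fun i hi j hj hne => ?_)).trans ?_
    · obtain ⟨hne, hi⟩ := Finset.mem_erase.1 hi
      have hm := (hmem _ _).1 (hμ i hi)
      have h := hsepN _ hm.1 n' hn'le (fun h => hne (by rw [← h, hm.2]))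
      rw [abs_of_nonneg (sub_nonneg.2 (hmin _ hm.1))] at h
      linarith [hf0 n']
    · have hmi := (hmem _ _).1 (hμ i (Finset.mem_of_mem_erase hi))
      have hmj := (hmem _ _).1 (hμ j (Finset.mem_of_mem_erase hj))
      exact hsepN _ hmi.1 _ hmj.1 (fun h => hne (by rw [← hmi.2, ← hmj.2, h]))
    · rw [Finset.card_erase_of_mem hn'block, Finset.card_range, Nat.add_sub_cancel,
        one_div_one_div, Real.mul_rpow zero_le_two hRr.le]
      have : ((N / Q : ℕ) : ℝ) ≤ (N : ℝ) / Q := Nat.cast_div_le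
      calc _ ≤ 2 ^ b * (R : ℝ) ^ b * (((N : ℝ) / Q) ^ (1 - b) / (1 - b)) := by gcongr
        _ = _ := by ring
  have hsplit : ∀ g : ℕ → ℝ, ∑ n ∈ (Finset.range (N + 1)).erase n', g n =
      ∑ j ∈ Finset.range (N / Q + 1), ∑ n ∈ (block j).erase (μ j), g n +
        ∑ j ∈ (Finset.range (N / Q + 1)).erase (n' / Q), g (μ j) := by
    intro g
    have hN : n' ∈ Finset.range (N + 1) := by simpa [Nat.lt_succ_iff] using hn'le
    have h1 := Finset.sum_erase_add _ g hN
    have h2 := Finset.sum_erase_add _ (fun j => g (μ j)) hn'block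
    have h3 : ∑ j ∈ Finset.range (N / Q + 1), ∑ n ∈ block j, g n =
        ∑ n ∈ Finset.range (N + 1), g n :=
      Finset.sum_fiberwise_of_maps_to (fun n hn => by
        simp only [Finset.mem_range, Nat.lt_succ_iff] at hn ⊢
        exact Nat.div_le_div_right hn) g
    have h4 : ∑ j ∈ Finset.range (N / Q + 1), ∑ n ∈ block j, g n =
        ∑ j ∈ Finset.range (N / Q + 1), ∑ n ∈ (block j).erase (μ j), g n +
          ∑ j ∈ Finset.range (N / Q + 1), g (μ j) := by
      rw [← Finset.sum_add_distrib]
      exact Finset.sum_congr rfl fun j hj => (Finset.sum_erase_add _ g (hμ j hj)).symm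
    simp only [hμn'] at h2
    linarith
  refine (hsplit fun n => 1 / f n ^ b).trans_le (add_le_add ?_ houter)
  refine (Finset.sum_le_sum hinner).trans ?_
  rw [Finset.sum_const, Finset.card_range, nsmul_eq_mul]
  have hcount : ((N / Q + 1 : ℕ) : ℝ) * Q ≤ 2 * N := by
    exact_mod_cast (by have := Nat.div_mul_le_self N Q; nlinarith : (N / Q + 1) * Q ≤ 2 * N)
  calc _ = 2 ^ b / (1 - b) * (((N / Q + 1 : ℕ) : ℝ) * Q) := by ring
    _ ≤ 2 ^ b / (1 - b) * (2 * N) := by gcongr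
    _ = _ := by rw [Real.rpow_add two_pos, Real.rpow_one]; ring
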